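/- Let X_1 and X_2 be iid random variables following the Gamma distribution with shape parameter α > 0 and rate parameter λ > 0. Then the classical Gini coefficient G = E[|X_1 − X_2|]/(2·E[X_1]) equals Γ(α + 1/2) / (√π · α · Γ(α)), where Γ denotes the gamma function. -/

import Mathlib

open MeasureTheory ProbabilityTheory

lemma aux_lintegral_gamma {s b : ℝ} (hs : 0 < s) (hb : 0 < b) :
    ∫⁻ x in Set.Ioi (0:ℝ), ENNReal.ofReal (x ^ (s - 1) * Real.exp (-(b * x)))
      = ENNReal.ofReal ((1 / b) ^ s * Real.Gamma s) := by
  have h := Real.integral_rpow_mul_exp_neg_mul_Ioi hs hb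
  have hpos : 0 < (1 / b) ^ s * Real.Gamma s :=
    mul_pos (Real.rpow_pos_of_pos (by positivity) _) (Real.Gamma_pos_of_pos hs)
  have hint : Integrable (fun x : ℝ => x ^ (s - 1) * Real.exp (-(b * x)))
      (volume.restrict (Set.Ioi (0:ℝ))) := by
    by_contra hn
    rw [integral_undef hn] at h
    exact hpos.ne h
  rw [← h, ofReal_integral_eq_lintegral_ofReal hint]
  refine (ae_restrict_iff' measurableSet_Ioi).mpr (ae_of_all _ fun x hx => ?_)
  have : (0:ℝ) < x := hx
  simp only [Pi.zero_apply]
  positivity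

lemma aux_lintegral_gammaMeasure (a r : ℝ) (g : ℝ → ENNReal) (hg : Measurable g) :
    ∫⁻ x, g x ∂(gammaMeasure a r) =
      ∫⁻ x in Set.Ioi (0:ℝ), ENNReal.ofReal
        (r ^ a / Real.Gamma a * x ^ (a - 1) * Real.exp (-(r * x))) * g x := by
  have hm : Measurable (gammaPDF a r) := (measurable_gammaPDFReal a r).ennreal_ofReal
  rw [gammaMeasure, lintegral_withDensity_eq_lintegral_mul _ hm hg,
    ← lintegral_add_compl _ (measurableSet_Ici (a := (0:ℝ)))]
  have h0 : ∫⁻ x in (Set.Ici (0:ℝ))ᶜ, (gammaPDF a r * g) x = 0 := by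
    rw [setLIntegral_congr_fun (g := fun _ => 0) measurableSet_Ici.compl]
    · simp
    · intro x hx
      have hx' : x < 0 := by simpa using hx
      simp [gammaPDF_of_neg hx']
  rw [h0, add_zero, setLIntegral_congr (Ioi_ae_eq_Ici (a := (0:ℝ))).symm]
  refine setLIntegral_congr_fun measurableSet_Ioi fun x hx => ?_
  simp only [Pi.mul_apply]
  rw [gammaPDF_of_nonneg (le_of_lt hx)]

lemma aux_scale {x : ℝ} (hx : 0 < x) (g : ℝ → ENNReal) :
    ∫⁻ y in Set.Ioi (0:ℝ), g y
      = ∫⁻ u in Set.Ioi (0:ℝ), ENNReal.ofReal x * g (x * u) := by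
  have himg : (fun u : ℝ => x * u) '' Set.Ioi 0 = Set.Ioi 0 := by
    ext y
    simp only [Set.mem_image, Set.mem_Ioi]
    constructor
    · rintro ⟨u, hu, rfl⟩; positivity
    · intro hy; exact ⟨y / x, by positivity, by field_simp⟩
  have h := lintegral_image_eq_lintegral_abs_deriv_mul (f := fun u : ℝ => x * u)
    (f' := fun _ => x) (measurableSet_Ioi (a := (0:ℝ)))
    (fun u _ => by simpa using ((hasDerivAt_id u).const_mul x).hasDerivWithinAt)
    (fun u _ v _ huv => mul_left_cancel₀ hx.ne' huv) g
  rw [himg, abs_of_pos hx] at h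
  exact h

lemma aux_u {a : ℝ} (ha : 0 < a) :
    ∫⁻ u in Set.Ioi (0:ℝ), ENNReal.ofReal
      (u ^ (a - 1) * (1 - u) * (1 + u) ^ (-(2 * a + 1)))
      = ENNReal.ofReal (2 ^ (-(2 * a)) / a) := by
  rw [← Set.Ioc_union_Ioi_eq_Ioi (zero_le_one (α := ℝ)),
    lintegral_union measurableSet_Ioi (Set.Ioc_disjoint_Ioi le_rfl)]
  have h0 : ∫⁻ u in Set.Ioi (1:ℝ), ENNReal.ofReal
      (u ^ (a - 1) * (1 - u) * (1 + u) ^ (-(2 * a + 1))) = 0 := by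
    rw [setLIntegral_congr_fun (g := fun _ => 0) measurableSet_Ioi]
    · simp
    · intro u hu
      have hu' : (1:ℝ) < u := hu
      refine ENNReal.ofReal_of_nonpos ?_
      refine mul_nonpos_of_nonpos_of_nonneg (mul_nonpos_of_nonneg_of_nonpos ?_ ?_) ?_
      · positivity
      · linarith
      · positivity
  rw [h0, add_zero]
  have hcont : ContinuousOn (fun u : ℝ => u ^ a * (1 + u) ^ (-(2 * a)) / a) (Set.Icc 0 1) := by
    refine ContinuousOn.div_const (ContinuousOn.mul ?_ ?_) _
    · exact (Real.continuous_rpow_const ha.le).continuousOn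
    · refine ContinuousOn.rpow_const (by fun_prop) fun u hu => Or.inl ?_
      have := hu.1
      positivity
  have hderiv : ∀ u ∈ Set.Ioo (0:ℝ) 1,
      HasDerivAt (fun u : ℝ => u ^ a * (1 + u) ^ (-(2 * a)) / a)
      (u ^ (a - 1) * (1 - u) * (1 + u) ^ (-(2 * a + 1))) u := by
    intro u hu
    have hu0 : 0 < u := hu.1
    have hu1 : 0 < 1 + u := by linarith
    have h1 := Real.hasDerivAt_rpow_const (x := u) (p := a) (Or.inl hu0.ne')
    have h2 := ((hasDerivAt_id u).const_add 1).rpow_const (p := -(2 * a)) (Or.inl hu1.ne')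
    refine ((h1.mul h2).div_const a).congr_deriv ?_
    simp only [id]
    have e1 : u ^ a = u ^ (a - 1) * u := by
      rw [← Real.rpow_add_one hu0.ne']; congr 1; ring
    have e2 : (1 + u) ^ (-(2 * a)) = (1 + u) ^ (-(2 * a + 1)) * (1 + u) := by
      rw [← Real.rpow_add_one hu1.ne']; congr 1; ring
    have e3 : -(2 * a) - 1 = -(2 * a + 1) := by ring
    rw [e3, e1, e2]
    field_simp
    ring
  have hnn : ∀ u ∈ Set.Ioo (0:ℝ) 1, 0 ≤ u ^ (a - 1) * (1 - u) * (1 + u) ^ (-(2 * a + 1)) := by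
    intro u hu
    have hu0 : 0 < u := hu.1
    have hu1 : 0 ≤ 1 - u := by linarith [hu.2]
    positivity
  have hint := intervalIntegral.integrableOn_deriv_of_nonneg hcont hderiv hnn
  have hval := intervalIntegral.integral_eq_sub_of_hasDerivAt_of_le zero_le_one hcont hderiv
    ((intervalIntegrable_iff_integrableOn_Ioc_of_le zero_le_one).2 hint)
  rw [intervalIntegral.integral_of_le zero_le_one] at hval
  rw [← ofReal_integral_eq_lintegral_ofReal hint, hval]
  · congr 1
    rw [Real.zero_rpow ha.ne']
    norm_num
  · refine (ae_restrict_iff' measurableSet_Ioc).mpr (ae_of_all _ fun u hu => ?_)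
    have hu0 : 0 < u := hu.1
    have hu1 : 0 ≤ 1 - u := by linarith [hu.2]
    simp only [Pi.zero_apply]
    positivity

lemma aux_J {a r : ℝ} (ha : 0 < a) (hr : 0 < r) :
    ∫⁻ x, ∫⁻ y, ENNReal.ofReal (x - y) ∂(gammaMeasure a r) ∂(gammaMeasure a r)
      = ENNReal.ofReal ((r ^ a / Real.Gamma a) ^ 2 *
          ((1 / r) ^ (2 * a + 1) * Real.Gamma (2 * a + 1)) * (2 ^ (-(2 * a)) / a)) := by
  haveI := isProbabilityMeasure_gammaMeasure ha hr
  have hG := Real.Gamma_pos_of_pos ha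
  have hG2 : 0 < Real.Gamma (2 * a + 1) := Real.Gamma_pos_of_pos (by positivity)
  rw [aux_lintegral_gammaMeasure _ _ _
    (Measurable.lintegral_prod_right' (f := fun p : ℝ × ℝ => ENNReal.ofReal (p.1 - p.2))
      (by fun_prop))]
  set c := r ^ a / Real.Gamma a with hc
  have hc0 : 0 < c := by positivity
  have step1 : ∀ x ∈ Set.Ioi (0:ℝ),
      ENNReal.ofReal (c * x ^ (a - 1) * Real.exp (-(r * x))) *
        ∫⁻ y, ENNReal.ofReal (x - y) ∂(gammaMeasure a r)
      = ∫⁻ u in Set.Ioi (0:ℝ), ENNReal.ofReal (c ^ 2 * (u ^ (a - 1) * (1 - u))) *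
          ENNReal.ofReal (x ^ (2 * a + 1 - 1) * Real.exp (-(r * (1 + u) * x))) := by
    intro x hx
    have hx0 : 0 < x := hx
    rw [aux_lintegral_gammaMeasure _ _ _ (by fun_prop), aux_scale hx0,
      ← lintegral_const_mul _ (by fun_prop)]
    refine setLIntegral_congr_fun measurableSet_Ioi fun u hu => ?_
    have hu0 : 0 < u := hu
    rw [← hc, ← ENNReal.ofReal_mul (by positivity), ← ENNReal.ofReal_mul (by positivity),
      ← ENNReal.ofReal_mul (by positivity), ← ENNReal.ofReal_mul' (by positivity)]
    congr 1
    have e1 : x ^ (2 * a + 1 - 1) = x ^ (a - 1) * x ^ (a - 1) * x * x := by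
      rw [← Real.rpow_add hx0, ← Real.rpow_add_one hx0.ne', ← Real.rpow_add_one hx0.ne']
      congr 1; ring
    have e2 : Real.exp (-(r * (1 + u) * x))
        = Real.exp (-(r * x)) * Real.exp (-(r * (x * u))) := by
      rw [← Real.exp_add]; congr 1; ring
    rw [e1, e2, Real.mul_rpow hx0.le hu0.le]
    ring
  rw [setLIntegral_congr_fun measurableSet_Ioi step1,
    lintegral_lintegral_swap (by fun_prop)]
  have step2 : ∀ u ∈ Set.Ioi (0:ℝ),
      ∫⁻ x in Set.Ioi (0:ℝ), ENNReal.ofReal (c ^ 2 * (u ^ (a - 1) * (1 - u))) *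
          ENNReal.ofReal (x ^ (2 * a + 1 - 1) * Real.exp (-(r * (1 + u) * x)))
      = ENNReal.ofReal (c ^ 2 * ((1 / r) ^ (2 * a + 1) * Real.Gamma (2 * a + 1))) *
        ENNReal.ofReal (u ^ (a - 1) * (1 - u) * (1 + u) ^ (-(2 * a + 1))) := by
    intro u hu
    have hu0 : 0 < u := hu
    rw [lintegral_const_mul _ (by fun_prop),
      aux_lintegral_gamma (by positivity) (by positivity),
      ← ENNReal.ofReal_mul' (by positivity), ← ENNReal.ofReal_mul (by positivity)]
    congr 1
    have e1 : (1 / (r * (1 + u))) ^ (2 * a + 1)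
        = (1 / r) ^ (2 * a + 1) * (1 + u) ^ (-(2 * a + 1)) := by
      rw [Real.rpow_neg (by positivity), ← Real.inv_rpow (by positivity),
        ← Real.mul_rpow (by positivity) (by positivity)]
      congr 1
      field_simp
    rw [e1]
    ring
  rw [setLIntegral_congr_fun measurableSet_Ioi step2, lintegral_const_mul _ (by fun_prop),
    aux_u ha, ← ENNReal.ofReal_mul (by positivity)]

lemma aux_mean {a r : ℝ} (ha : 0 < a) (hr : 0 < r) :
    ∫ x, x ∂(gammaMeasure a r) = a / r := by
  have hG := Real.Gamma_pos_of_pos ha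
  have hnn : 0 ≤ᵐ[gammaMeasure a r] fun x : ℝ => x := by
    have h0 : gammaMeasure a r (Set.Iio 0) = 0 := by
      rw [gammaMeasure, withDensity_apply _ measurableSet_Iio]
      exact lintegral_gammaPDF_of_nonpos le_rfl
    rw [Filter.EventuallyLE, ae_iff]
    convert h0 using 2
    ext x; simp
  rw [integral_eq_lintegral_of_nonneg_ae hnn (by fun_prop),
    aux_lintegral_gammaMeasure _ _ _ (by fun_prop)]
  have : ∀ x ∈ Set.Ioi (0:ℝ), ENNReal.ofReal
        (r ^ a / Real.Gamma a * x ^ (a - 1) * Real.exp (-(r * x))) * ENNReal.ofReal x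
      = ENNReal.ofReal (r ^ a / Real.Gamma a) *
        ENNReal.ofReal (x ^ (a + 1 - 1) * Real.exp (-(r * x))) := by
    intro x hx
    have hx0 : 0 < x := hx
    rw [← ENNReal.ofReal_mul (by positivity), ← ENNReal.ofReal_mul (by positivity)]
    congr 1
    have e1 : x ^ (a + 1 - 1) = x ^ (a - 1) * x := by
      rw [← Real.rpow_add_one hx0.ne']; congr 1; ring
    rw [e1]; ring
  rw [setLIntegral_congr_fun measurableSet_Ioi this, lintegral_const_mul _ (by fun_prop),
    aux_lintegral_gamma (by positivity) hr, ← ENNReal.ofReal_mul (by positivity),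
    Real.Gamma_add_one ha.ne', ENNReal.toReal_ofReal (by positivity), one_div,
    Real.inv_rpow hr.le, Real.rpow_add_one hr.ne']
  field_simp

/-- **The classical Gini coefficient under the gamma distribution (McDonald–Jensen).**
If `X₁, X₂` are iid `Gamma(α, λ)`, then
`G = E[|X₁ − X₂|]/(2 E[X₁]) = Γ(α + 1/2)/(√π · α · Γ(α))`. -/
theorem gini_coefficient_gamma
    {Ω : Type*} [MeasurableSpace Ω] (P : Measure Ω) [IsProbabilityMeasure P]
    (α lam : ℝ) (hα : 0 < α) (hlam : 0 < lam)
    (X₁ X₂ : Ω → ℝ) (hX₁ : Measurable X₁) (hX₂ : Measurable X₂)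
    (hindep : IndepFun X₁ X₂ P)
    (hident₁ : Measure.map X₁ P = gammaMeasure α lam)
    (hident₂ : Measure.map X₂ P = gammaMeasure α lam) :
    (∫ ω, |X₁ ω - X₂ ω| ∂P) / (2 * ∫ ω, X₁ ω ∂P)
      = Real.Gamma (α + 1/2) / (Real.sqrt Real.pi * α * Real.Gamma α) := by
  haveI := isProbabilityMeasure_gammaMeasure hα hlam
  have hG := Real.Gamma_pos_of_pos hα
  have hG2 : 0 < Real.Gamma (2 * α + 1) := Real.Gamma_pos_of_pos (by positivity)
  have hmean : ∫ ω, X₁ ω ∂P = α / lam := by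
    rw [← aux_mean hα hlam, ← hident₁, integral_map hX₁.aemeasurable (by fun_prop)]
  have hjoint : Measure.map (fun ω => (X₁ ω, X₂ ω)) P
      = (gammaMeasure α lam).prod (gammaMeasure α lam) := by
    rw [(indepFun_iff_map_prod_eq_prod_map_map hX₁.aemeasurable hX₂.aemeasurable).1 hindep,
      hident₁, hident₂]
  have hsplit : ∀ x y : ℝ, ENNReal.ofReal |x - y|
      = ENNReal.ofReal (x - y) + ENNReal.ofReal (y - x) := by
    intro x y
    rcases le_total x y with h | h
    · rw [abs_of_nonpos (by linarith), ENNReal.ofReal_of_nonpos (p := x - y) (by linarith),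
        zero_add, neg_sub]
    · rw [abs_of_nonneg (by linarith), ENNReal.ofReal_of_nonpos (p := y - x) (by linarith),
        add_zero]
  have hnum : ∫ ω, |X₁ ω - X₂ ω| ∂P = 2 * ((lam ^ α / Real.Gamma α) ^ 2 *
          ((1 / lam) ^ (2 * α + 1) * Real.Gamma (2 * α + 1)) * (2 ^ (-(2 * α)) / α)) := by
    rw [integral_eq_lintegral_of_nonneg_ae (ae_of_all _ fun _ => abs_nonneg _)
      (by fun_prop)]
    have e : ∫⁻ ω, ENNReal.ofReal |X₁ ω - X₂ ω| ∂P
        = ∫⁻ p, ENNReal.ofReal |p.1 - p.2| ∂(Measure.map (fun ω => (X₁ ω, X₂ ω)) P) := by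
      rw [lintegral_map (by fun_prop) (by fun_prop)]
    rw [e, hjoint]
    simp_rw [hsplit]
    rw [lintegral_add_left (by fun_prop), lintegral_prod _ (by fun_prop),
      lintegral_prod_symm _ (by fun_prop), aux_J hα hlam,
      ENNReal.toReal_add ENNReal.ofReal_ne_top ENNReal.ofReal_ne_top,
      ENNReal.toReal_ofReal (by positivity)]
    ring
  rw [hnum, hmean]
  have hdup := Real.Gamma_mul_Gamma_add_half α
  have hhalf : Real.Gamma (α + 1/2)
      = Real.Gamma (2 * α) * 2 ^ (1 - 2 * α) * Real.sqrt Real.pi / Real.Gamma α := by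
    rw [← hdup]; field_simp
  have e2 : (2:ℝ) ^ (1 - 2 * α) = 2 * 2 ^ (-(2 * α)) := by
    rw [sub_eq_add_neg, Real.rpow_add two_pos, Real.rpow_one]
  have e3 : (1 / lam) ^ (2 * α + 1) = (lam ^ α * lam ^ α * lam)⁻¹ := by
    rw [one_div, Real.inv_rpow hlam.le, Real.rpow_add_one hlam.ne', two_mul, Real.rpow_add hlam]
  have hl : 0 < lam ^ α := by positivity
  have hpi : 0 < Real.sqrt Real.pi := Real.sqrt_pos.2 Real.pi_pos
  rw [hhalf, e2, e3, Real.Gamma_add_one (by positivity)]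
  field_simp
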